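/- Let G be a countable group. Then G has the strong topological Rokhlin property if and only if the following holds: for every finite set A with at least two elements, every finite set B with at least two elements, every subshift of finite type Z ⊆ B^G, every continuous G-equivariant map φ : Z → A^G with image X := φ(Z), and every finite set F ⊆ G, there exist a sofic subshift Y ⊆ Z with (φ(Y))_F = X_F, a finite set C with at least two elements, a subshift of finite type V ⊆ C^G, a continuous G-equivariant surjection ψ : V → Y, and a finite partition 𝒫 of V into nonempty subsets that are clopen in V, such that φ(Y) is 𝒜-minimal for the family 𝒜 = { (φ ∘ ψ)(P) : P ∈ 𝒫 }. -/

import Mathlib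

open Topology

/-- The Cantor space `𝒞`. -/
abbrev Cantor : Type := ℕ → Bool

/-- `α : G → C(𝒞,𝒞)` is a continuous action if it is a homomorphism into the
self-homeomorphisms of `𝒞` (recorded as continuous maps; continuity of the inverse
`α g⁻¹` is automatic from the homomorphism equations). -/
def IsAction (G : Type) [Group G] (α : G → C(Cantor, Cantor)) : Prop :=
  α 1 = ContinuousMap.id Cantor ∧ ∀ g h : G, α (g * h) = (α g).comp (α h)

/-- The space `Act_G(𝒞)` of continuous actions of `G` on the Cantor space,
topologized as a subspace of `C(𝒞,𝒞)^G` (compact-open topology on each factor). -/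
abbrev ActSpace (G : Type) [Group G] : Type :=
  {α : G → C(Cantor, Cantor) // IsAction G α}

/-- The conjugacy class of an action `α` under the conjugation action of `Homeo(𝒞)`. -/
def conjClass {G : Type} [Group G] (α : ActSpace G) : Set (ActSpace G) :=
  {β | ∃ φ : Cantor ≃ₜ Cantor, ∀ g : G,
    (β.1 g : Cantor → Cantor) = φ ∘ (α.1 g : Cantor → Cantor) ∘ φ.symm}

/-- The strong topological Rokhlin property: some action on the Cantor space has a
comeager conjugacy class. -/
def HasSTRP (G : Type) [Group G] : Prop :=
  ∃ α : ActSpace G, conjClass α ∈ residual (ActSpace G)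

/-- The shift action of `G` on `A^G`: `(g • x)(h) = x(g⁻¹h)`. -/
def shift {G : Type} [Group G] {A : Type} (g : G) (x : G → A) : G → A :=
  fun h => x (g⁻¹ * h)

/-- A subshift: closed (in the product of discrete topologies) and shift-invariant. -/
def IsSubshift (G : Type) [Group G] (A : Type) (X : Set (G → A)) : Prop :=
  (letI : TopologicalSpace A := ⊥; IsClosed X) ∧ ∀ g : G, ∀ x ∈ X, shift g x ∈ X

/-- The set `X_F` of `F`-patterns of `X`. -/
def patterns {G A : Type} (F : Finset G) (X : Set (G → A)) : Set (F → A) :=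
  (fun (x : G → A) (f : F) => x (f : G)) '' X

/-- Subshift of finite type, with defining window `E` and allowed patterns `𝔽`. -/
def IsSFT (G : Type) [Group G] (A : Type) (X : Set (G → A)) : Prop :=
  ∃ (E : Finset G) (𝔽 : Set (E → A)),
    ∀ x : G → A, x ∈ X ↔ ∀ g : G, (fun e : E => shift g x (e : G)) ∈ 𝔽

/-- Continuity on a set, for a map between full shift spaces over discrete alphabets. -/
def ContinuousOnD {G A B : Type} (ψ : (G → B) → (G → A)) (Z : Set (G → B)) : Prop :=
  letI : TopologicalSpace A := ⊥
  letI : TopologicalSpace B := ⊥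
  ContinuousOn ψ Z

/-- `G`-equivariance of a map between shift spaces, on a set. -/
def EquivariantOn {G A B : Type} [Group G] (ψ : (G → B) → (G → A)) (Z : Set (G → B)) : Prop :=
  ∀ g : G, ∀ z ∈ Z, ψ (shift g z) = shift g (ψ z)

/-- A sofic subshift: a continuous `G`-equivariant image of a subshift of finite type. -/
def IsSofic (G : Type) [Group G] (A : Type) (X : Set (G → A)) : Prop :=
  ∃ (B : Type) (_ : Fintype B) (_ : Nontrivial B) (Z : Set (G → B))
    (ψ : (G → B) → (G → A)),
    IsSubshift G B Z ∧ IsSFT G B Z ∧ ContinuousOnD ψ Z ∧ EquivariantOn ψ Z ∧ ψ '' Z = X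

/-- The sliding block code `Φ(y)(g) = f(d ↦ y(g·d))` induced by `f : (D → B) → A`. -/
def slidingBlock {G : Type} [Group G] {A B : Type} (D : Finset G)
    (f : (D → B) → A) : (G → B) → (G → A) :=
  fun y g => f (fun d => y (g * (d : G)))

/-- A projectively isolated subshift. -/
def ProjIsolated (G : Type) [Group G] (A : Type) (X : Set (G → A)) : Prop :=
  ∃ (B : Type) (_ : Fintype B) (_ : Nontrivial B) (Y : Set (G → B))
    (F D : Finset G) (f : (D → B) → A),
    IsSubshift G B Y ∧
    slidingBlock D f '' Y = X ∧
    ∀ Z : Set (G → B), IsSubshift G B Z → patterns F Z = patterns F Y →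
      slidingBlock D f '' Z = X

/-- An isolated subshift: an SFT `X` such that for some finite `F ⊆ G` no proper
subshift has the same `F`-patterns as `X`. -/
def IsIsolated (G : Type) [Group G] (A : Type) (X : Set (G → A)) : Prop :=
  IsSFT G A X ∧ ∃ F : Finset G, ∀ Y : Set (G → A),
    IsSubshift G A Y → Y ⊂ X → patterns F Y ≠ patterns F X

/-- A strongly projectively isolated subshift: a continuous `G`-equivariant image of an
isolated subshift. -/
def StronglyProjIsolated (G : Type) [Group G] (A : Type) (X : Set (G → A)) : Prop :=
  ∃ (B : Type) (_ : Fintype B) (_ : Nontrivial B) (Y : Set (G → B))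
    (ψ : (G → B) → (G → A)),
    IsSubshift G B Y ∧ IsIsolated G B Y ∧
    ContinuousOnD ψ Y ∧ EquivariantOn ψ Y ∧ ψ '' Y = X

/-- Shadowing (the pseudo-orbit tracing property) of an action `act` of `G`,
with respect to a distance function `d`. -/
def HasShadowing {G X : Type} [Group G] (d : X → X → ℝ) (act : G → X → X) : Prop :=
  ∀ ε : ℝ, 0 < ε → ∃ (δ : ℝ) (S : Finset G), 0 < δ ∧
    ∀ x : G → X, (∀ g : G, ∀ s ∈ S, d (act s (x g)) (x (s * g)) < δ) →
      ∃ y : X, ∀ g : G, d (x g) (act g y) < ε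

/-- A finite partition of the whole space into nonempty clopen sets. -/
def IsClopenPartition {X : Type} [TopologicalSpace X] (parts : Finset (Set X)) : Prop :=
  (∀ P ∈ parts, IsClopen P ∧ P.Nonempty) ∧
  (∀ P ∈ parts, ∀ Q ∈ parts, P ≠ Q → Disjoint P Q) ∧
  (⋃ P ∈ parts, P) = Set.univ

/-- A finite partition of a subshift `X` into nonempty subsets that are clopen in `X`. -/
def IsClopenPartitionIn {G A : Type} (X : Set (G → A)) (parts : Finset (Set (G → A))) : Prop :=
  (letI : TopologicalSpace A := ⊥;
    ∀ P ∈ parts, P.Nonempty ∧ P ⊆ X ∧ IsClopen (Subtype.val ⁻¹' P : Set X)) ∧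
  (∀ P ∈ parts, ∀ Q ∈ parts, P ≠ Q → Disjoint P Q) ∧
  (⋃ P ∈ parts, P) = X

/-- `X` is `fam`-minimal: no nonempty proper subshift of `X` meets every member of `fam`. -/
def AMinimal {G A : Type} [Group G] (X : Set (G → A)) (fam : Set (Set (G → A))) : Prop :=
  ¬ ∃ Y : Set (G → A), IsSubshift G A Y ∧ Y.Nonempty ∧ Y ⊂ X ∧
    ∀ S ∈ fam, (Y ∩ S).Nonempty

/-- The free product of a subshift `V ⊆ B^G` and a subshift `W ⊆ B^H`, a subshift
of `B^(G∗H)`. -/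
def freeProd {G H B : Type} [Group G] [Group H]
    (V : Set (G → B)) (W : Set (H → B)) : Set (Monoid.Coprod G H → B) :=
  {x | ∀ g : Monoid.Coprod G H,
    (fun h : G => x (g * Monoid.Coprod.inl h)) ∈ V ∧
    (fun k : H => x (g * Monoid.Coprod.inr k)) ∈ W}

/-- Continuity of a map into a finite (discrete) alphabet. -/
def ContinuousToDiscrete {X A : Type} [TopologicalSpace X] (c : X → A) : Prop :=
  letI : TopologicalSpace A := ⊥
  Continuous c

/-- Continuity of a map into the shift space `A^G` over a discrete alphabet `A`. -/
def ContinuousIntoShift {X G A : Type} [TopologicalSpace X] (φ : X → (G → A)) : Prop :=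
  letI : TopologicalSpace A := ⊥
  Continuous φ

/-- Two labelings combined into a single one. -/
def labelPair {X : Type} [TopologicalSpace X] (p q : C(X, ℕ)) : C(X, ℕ) :=
  ⟨fun x => Nat.pair (p x) (q x),
    (continuous_of_discreteTopology (f := fun z : ℕ × ℕ => Nat.pair z.1 z.2)).comp
      (p.continuous.prodMk q.continuous)⟩

/-- A labeling composed with a relabeling. -/
def labelMap {X : Type} [TopologicalSpace X] (f : ℕ → ℕ) (p : C(X, ℕ)) : C(X, ℕ) :=
  ⟨fun x => f (p x), continuous_of_discreteTopology.comp p.continuous⟩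

@[simp] theorem labelPair_apply {X : Type} [TopologicalSpace X] (p q : C(X, ℕ)) (x : X) :
    labelPair p q x = Nat.pair (p x) (q x) := rfl

@[simp] theorem labelMap_apply {X : Type} [TopologicalSpace X] (f : ℕ → ℕ) (p : C(X, ℕ)) (x : X) :
    labelMap f p x = f (p x) := rfl

/-- No point of the space is isolated. -/
def NoIsolatedPoints (X : Type) [TopologicalSpace X] : Prop :=
  ∀ U : Set X, IsOpen U → ∀ x ∈ U, ∃ y ∈ U, y ≠ x

theorem discreteTopology_labelings (X : Type) [TopologicalSpace X] [CompactSpace X] :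
    DiscreteTopology C(X, ℕ) := by
  refine discreteTopology_iff_isOpen_singleton.2 fun p => ?_
  have hU : Metric.ball p 1 = {p} := by
    ext q
    simp only [Metric.mem_ball, Set.mem_singleton_iff]
    refine ⟨fun h => ?_, fun h => by simp [h]⟩
    ext x
    have h1 : dist (q x) (p x) < 1 := lt_of_le_of_lt (ContinuousMap.dist_apply_le_dist x) h
    rw [Nat.dist_eq] at h1
    have : |((q x : ℤ) - (p x : ℤ))| < 1 := by exact_mod_cast h1
    rw [Int.abs_lt_one_iff] at this
    omega
  rw [← hU]
  exact Metric.isOpen_ball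

theorem countable_labelings (X : Type) [TopologicalSpace X] [CompactSpace X] [T2Space X]
    [SecondCountableTopology X] : Countable C(X, ℕ) := by
  have := discreteTopology_labelings X
  exact TopologicalSpace.separableSpace_iff_countable.1 inferInstance

theorem exists_label_ne {X : Type} [TopologicalSpace X] [CompactSpace X] [T2Space X]
    [TotallyDisconnectedSpace X] {x y : X} (h : x ≠ y) :
    ∃ p : C(X, ℕ), p x = 1 ∧ p y = 0 := by
  classical
  obtain ⟨U, hU, hx, hy⟩ := exists_isClopen_of_totally_separated h
  refine ⟨⟨LocallyConstant.charFn ℕ hU, (LocallyConstant.charFn ℕ hU).continuous⟩,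
    (LocallyConstant.charFn_eq_one ℕ x hU).2 hx, (LocallyConstant.charFn_eq_zero ℕ y hU).2 hy⟩

theorem exists_homeomorph_of_backForth {X Y ι : Type}
    [TopologicalSpace X] [CompactSpace X] [T2Space X] [TotallyDisconnectedSpace X]
    [SecondCountableTopology X]
    [TopologicalSpace Y] [CompactSpace Y] [T2Space Y] [TotallyDisconnectedSpace Y]
    [SecondCountableTopology Y]
    (e : ι) (a : ι → C(X, X)) (b : ι → C(Y, Y))
    (ha : a e = ContinuousMap.id X) (hb : b e = ContinuousMap.id Y)
    (forth : ∀ (p : C(X, ℕ)) (q : C(Y, ℕ)) (p' : C(X, ℕ)),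
      Set.range (fun x i => p (a i x)) = Set.range (fun y i => q (b i y)) →
      ∃ q' : C(Y, ℕ), Set.range (fun x i => labelPair p p' (a i x)) =
        Set.range (fun y i => labelPair q q' (b i y)))
    (back : ∀ (p : C(X, ℕ)) (q : C(Y, ℕ)) (q' : C(Y, ℕ)),
      Set.range (fun x i => p (a i x)) = Set.range (fun y i => q (b i y)) →
      ∃ p' : C(X, ℕ), Set.range (fun x i => labelPair p p' (a i x)) =
        Set.range (fun y i => labelPair q q' (b i y)))
    (p₀ : C(X, ℕ)) (q₀ : C(Y, ℕ))
    (h₀ : Set.range (fun x i => p₀ (a i x)) = Set.range (fun y i => q₀ (b i y))) :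
    ∃ h : X ≃ₜ Y, (∀ x, q₀ (h x) = p₀ x) ∧ ∀ i x, h (a i x) = b i (h x) := by
  have := countable_labelings X
  have := countable_labelings Y
  have : Nonempty C(X, ℕ) := ⟨p₀⟩
  have : Nonempty C(Y, ℕ) := ⟨q₀⟩
  obtain ⟨u, hu⟩ := exists_surjective_nat C(X, ℕ)
  obtain ⟨v, hv⟩ := exists_surjective_nat C(Y, ℕ)
  let R : C(X, ℕ) × C(Y, ℕ) → Prop := fun z =>
    Set.range (fun x i => z.1 (a i x)) = Set.range (fun y i => z.2 (b i y))
  have step : ∀ (n : ℕ) (z : {z // R z}), ∃ w : {w // R w}, ∃ (p' : C(X, ℕ)) (q' : C(Y, ℕ)),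
      w.1.1 = labelPair (labelPair z.1.1 (u n)) p' ∧
      w.1.2 = labelPair (labelPair z.1.2 q') (v n) := by
    rintro n ⟨⟨p, q⟩, hz⟩
    obtain ⟨q', hq'⟩ := forth p q (u n) hz
    obtain ⟨p', hp'⟩ := back _ _ (v n) hq'
    exact ⟨⟨(_, _), hp'⟩, p', q', rfl, rfl⟩
  choose nxt P' Q' hnxt1 hnxt2 using step
  let s : ℕ → {z // R z} := fun n => Nat.rec ⟨(p₀, q₀), h₀⟩ nxt n
  have hs1 : ∀ n, (s (n + 1)).1.1 = labelPair (labelPair (s n).1.1 (u n)) (P' n (s n)) :=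
    fun n => hnxt1 n (s n)
  have hs2 : ∀ n, (s (n + 1)).1.2 = labelPair (labelPair (s n).1.2 (Q' n (s n))) (v n) :=
    fun n => hnxt2 n (s n)
  have hR : ∀ n, Set.range (fun x i => (s n).1.1 (a i x)) =
    Set.range (fun y i => (s n).1.2 (b i y)) := fun n => (s n).2
  have hstep : ∀ n x y, (s (n + 1)).1.2 y = (s (n + 1)).1.1 x →
      (s n).1.2 y = (s n).1.1 x := by
    intro n x y h
    rw [hs1, hs2] at h
    simp only [labelPair_apply, Nat.pair_eq_pair] at h
    exact h.1.1
  have sepX : ∀ x x', (∀ n, (s n).1.1 x = (s n).1.1 x') → x = x' := by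
    intro x x' h
    by_contra hne
    obtain ⟨p, h1, h0⟩ := exists_label_ne hne
    obtain ⟨n, rfl⟩ := hu p
    have := h (n + 1)
    rw [hs1] at this
    simp only [labelPair_apply, Nat.pair_eq_pair] at this
    omega
  have sepY : ∀ y y', (∀ n, (s n).1.2 y = (s n).1.2 y') → y = y' := by
    intro x x' h
    by_contra hne
    obtain ⟨p, h1, h0⟩ := exists_label_ne hne
    obtain ⟨n, rfl⟩ := hv p
    have := h (n + 1)
    rw [hs2] at this
    simp only [labelPair_apply, Nat.pair_eq_pair] at this
    omega
  have exY : ∀ x, ∃ y, ∀ n i, (s n).1.2 (b i y) = (s n).1.1 (a i x) := by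
    intro x
    obtain ⟨y, hy⟩ := IsCompact.nonempty_iInter_of_sequence_nonempty_isCompact_isClosed
      (fun n => {y | ∀ i, (s n).1.2 (b i y) = (s n).1.1 (a i x)})
      (fun n y hy i => hstep n _ _ (hy i))
      (fun n => by
        have : (fun i => (s n).1.1 (a i x)) ∈ Set.range (fun y i => (s n).1.2 (b i y)) := by
          rw [← hR n]; exact ⟨x, rfl⟩
        obtain ⟨y, hy⟩ := this
        exact ⟨y, fun i => congrFun hy i⟩)
      (IsClosed.isCompact (by
        simp only [Set.ofPred_forall]
        exact isClosed_iInter fun i => isClosed_eq (by fun_prop) continuous_const))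
      (fun n => by
        simp only [Set.ofPred_forall]
        exact isClosed_iInter fun i => isClosed_eq (by fun_prop) continuous_const)
    exact ⟨y, fun n i => Set.mem_iInter.1 hy n i⟩
  have exX : ∀ y, ∃ x, ∀ n i, (s n).1.2 (b i y) = (s n).1.1 (a i x) := by
    intro y
    obtain ⟨x, hx⟩ := IsCompact.nonempty_iInter_of_sequence_nonempty_isCompact_isClosed
      (fun n => {x | ∀ i, (s n).1.2 (b i y) = (s n).1.1 (a i x)})
      (fun n y hy i => hstep n _ _ (hy i))
      (fun n => by
        have : (fun i => (s n).1.2 (b i y)) ∈ Set.range (fun x i => (s n).1.1 (a i x)) := by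
          rw [hR n]; exact ⟨y, rfl⟩
        obtain ⟨x, hx⟩ := this
        exact ⟨x, fun i => (congrFun hx i).symm⟩)
      (IsClosed.isCompact (by
        simp only [Set.ofPred_forall]
        exact isClosed_iInter fun i => isClosed_eq continuous_const (by fun_prop)))
      (fun n => by
        simp only [Set.ofPred_forall]
        exact isClosed_iInter fun i => isClosed_eq continuous_const (by fun_prop))
    exact ⟨x, fun n i => Set.mem_iInter.1 hx n i⟩
  choose f hf using exY
  choose g hg using exX
  have hfe : ∀ x n, (s n).1.2 (f x) = (s n).1.1 x := fun x n => by simpa [ha, hb] using hf x n e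
  have hge : ∀ y n, (s n).1.2 y = (s n).1.1 (g y) := fun x n => by simpa [ha, hb] using hg x n e
  have hcont : Continuous f := by
    have hq : Continuous fun y n => (s n).1.2 y := continuous_pi fun n => (s n).1.2.continuous
    have hemb := hq.isClosedEmbedding fun y y' h => sepY y y' (congrFun h)
    rw [hemb.isEmbedding.continuous_iff]
    exact continuous_pi fun n => by
      simp only [Function.comp_apply, hfe]
      exact (s n).1.1.continuous
  refine ⟨Continuous.homeoOfEquivCompactToT2 (f := ⟨f, g, fun x => sepX _ _ fun n => ?_,
    fun y => sepY _ _ fun n => ?_⟩) hcont, fun x => hfe x 0, fun i x => sepY _ _ fun n => ?_⟩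
  · rw [← hge, hfe]
  · rw [hfe, hge]
  · exact (hfe _ n).trans (hf x n i).symm

theorem NoIsolatedPoints.exists_label_image {Y : Type} [TopologicalSpace Y] [CompactSpace Y]
    [T2Space Y] [TotallyDisconnectedSpace Y] (hY : NoIsolatedPoints Y) {U : Set Y}
    (hU : IsOpen U) (hne : U.Nonempty) (T : Finset ℕ) (hT : T.Nonempty) :
    ∃ f : C(Y, ℕ), f '' U = T := by
  classical
  induction hT using Finset.Nonempty.cons_induction with
  | singleton t =>
    exact ⟨⟨fun _ => t, continuous_const⟩, by simpa using Set.Nonempty.image_const hne t⟩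
  | cons t T ht hT ih =>
    obtain ⟨f, hf⟩ := ih
    obtain ⟨y, hy⟩ := hne
    obtain ⟨y', ⟨hy'U, hy'f⟩, hy'⟩ := hY (U ∩ f ⁻¹' {f y})
      (hU.inter ((isOpen_discrete _).preimage f.continuous)) y ⟨hy, rfl⟩
    obtain ⟨k, hk1, hk0⟩ := exists_label_ne hy'
    let φ : ℕ → ℕ := fun n => if (Nat.unpair n).1 = 1 ∧ (Nat.unpair n).2 = f y then t
      else (Nat.unpair n).2
    refine ⟨labelMap φ (labelPair k f), ?_⟩
    ext n
    simp only [Set.mem_image, labelMap_apply, labelPair_apply, φ, Nat.unpair_pair,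
      Finset.coe_cons, Set.mem_insert_iff, Finset.mem_coe]
    constructor
    · rintro ⟨z, hz, rfl⟩
      split_ifs with h
      · exact Or.inl rfl
      · right
        have : f z ∈ f '' U := ⟨z, hz, rfl⟩
        rw [hf] at this
        exact this
    · rintro (rfl | h)
      · exact ⟨y', hy'U, by rw [if_pos ⟨hk1, hy'f⟩]⟩
      · have : n ∈ f '' U := by rw [hf]; exact h
        obtain ⟨z, hz, rfl⟩ := this
        by_cases hzy : f z = f y
        · exact ⟨y, hy, by rw [if_neg (by simp [hk0]), hzy]⟩
        · exact ⟨z, hz, by rw [if_neg (by simp [hzy])]⟩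

theorem NoIsolatedPoints.exists_range_labelPair_eq {X Y : Type} [TopologicalSpace X]
    [CompactSpace X] [TopologicalSpace Y] [CompactSpace Y]
    [T2Space Y] [TotallyDisconnectedSpace Y] (hY : NoIsolatedPoints Y)
    (p p' : C(X, ℕ)) (q : C(Y, ℕ)) (h : Set.range p = Set.range q) :
    ∃ q' : C(Y, ℕ), Set.range (labelPair p p') = Set.range (labelPair q q') := by
  classical
  have hfin : ∀ n, (p' '' (p ⁻¹' {n})).Finite := fun n =>
    (isCompact_range p'.continuous).finite_of_discrete.subset (Set.image_subset_range _ _)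
  have key : ∀ n, ∃ f : C(Y, ℕ), n ∈ Set.range p → f '' (q ⁻¹' {n}) = p' '' (p ⁻¹' {n}) := by
    intro n
    by_cases hn : n ∈ Set.range p
    · obtain ⟨x, hx⟩ := hn
      obtain ⟨y, hy⟩ : n ∈ Set.range q := h ▸ ⟨x, hx⟩
      obtain ⟨f, hf⟩ := hY.exists_label_image (U := q ⁻¹' {n})
        ((isOpen_discrete _).preimage q.continuous) ⟨y, hy⟩ (hfin n).toFinset
        (by rw [Set.Finite.toFinset_nonempty]; exact ⟨_, x, hx, rfl⟩)
      exact ⟨f, fun _ => by simpa using hf⟩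
    · exact ⟨0, fun h => absurd h hn⟩
  choose f hf using key
  have hcont : Continuous fun y => f (q y) y := by
    have : Continuous fun z : ℕ × Y => f z.1 z.2 :=
      continuous_prod_of_discrete_left.2 fun n => (f n).continuous
    exact this.comp (q.continuous.prodMk continuous_id)
  refine ⟨⟨_, hcont⟩, ?_⟩
  ext n
  constructor
  · rintro ⟨x, rfl⟩
    have : p' x ∈ f (p x) '' (q ⁻¹' {p x}) := by
      rw [hf _ ⟨x, rfl⟩]
      exact ⟨x, rfl, rfl⟩
    obtain ⟨y, hy, hy'⟩ := this
    have hy : q y = p x := hy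
    exact ⟨y, by simp [hy, hy']⟩
  · rintro ⟨y, rfl⟩
    have : f (q y) y ∈ p' '' (p ⁻¹' {q y}) := by
      rw [← hf (q y) (h ▸ ⟨y, rfl⟩)]
      exact ⟨y, rfl, rfl⟩
    obtain ⟨x, hx, hx'⟩ := this
    have hx : p x = q y := hx
    exact ⟨x, by simp [hx, hx']⟩

/-- A version of Brouwer's characterization of the Cantor space, with prescribed labels. -/
theorem exists_homeomorph_of_range_eq {X Y : Type}
    [TopologicalSpace X] [CompactSpace X] [T2Space X] [TotallyDisconnectedSpace X]
    [SecondCountableTopology X]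
    [TopologicalSpace Y] [CompactSpace Y] [T2Space Y] [TotallyDisconnectedSpace Y]
    [SecondCountableTopology Y] (hX : NoIsolatedPoints X) (hY : NoIsolatedPoints Y)
    (p : C(X, ℕ)) (q : C(Y, ℕ)) (h : Set.range p = Set.range q) :
    ∃ h : X ≃ₜ Y, ∀ x, q (h x) = p x := by
  have key : ∀ {X Y : Type} [TopologicalSpace X] [TopologicalSpace Y] (p : C(X, ℕ)) (q : C(Y, ℕ)),
      (Set.range (fun x (i : Unit) => p (ContinuousMap.id X x)) =
        Set.range (fun y (i : Unit) => q (ContinuousMap.id Y y))) ↔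
      Set.range p = Set.range q := by
    intro X Y _ _ p q
    have hinj : Function.Injective (fun (n : ℕ) (_ : Unit) => n) := fun m n h => congrFun h ()
    have e1 : Set.range (fun x (i : Unit) => p (ContinuousMap.id X x)) =
      (fun (n : ℕ) (_ : Unit) => n) '' Set.range p := by rw [← Set.range_comp]; rfl
    have e2 : Set.range (fun x (i : Unit) => q (ContinuousMap.id Y x)) =
      (fun (n : ℕ) (_ : Unit) => n) '' Set.range q := by rw [← Set.range_comp]; rfl
    rw [e1, e2, hinj.image_injective.eq_iff]
  obtain ⟨h, hh, -⟩ := exists_homeomorph_of_backForth (ι := Unit) ()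
    (fun _ => ContinuousMap.id X) (fun _ => ContinuousMap.id Y) rfl rfl
    (fun p q p' h => by
      obtain ⟨q', hq'⟩ := hY.exists_range_labelPair_eq p p' q ((key _ _).1 h)
      exact ⟨q', (key _ _).2 hq'⟩)
    (fun p q q' h => by
      obtain ⟨p', hp'⟩ := hX.exists_range_labelPair_eq q q' p ((key _ _).1 h).symm
      exact ⟨p', (key _ _).2 hp'.symm⟩) p q ((key _ _).2 h)
  exact ⟨h, hh⟩

/-- `a` is an action of `G` on `X` by continuous maps. -/
def IsSystem {G X : Type} [Group G] [TopologicalSpace X] (a : G → C(X, X)) : Prop :=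
  a 1 = ContinuousMap.id X ∧ ∀ g h : G, a (g * h) = (a g).comp (a h)

/-- The itinerary map `X → ℕ^G` of a labeling `P` under a family of maps. -/
def code {G X : Type} [Group G] [TopologicalSpace X] (a : G → C(X, X)) (P : C(X, ℕ)) (x : X) :
    G → ℕ := fun g => P (a g⁻¹ x)

theorem noIsolatedPoints_cantor : NoIsolatedPoints Cantor := by
  classical
  intro U hU x hx
  obtain ⟨I, u, hu, hIU⟩ := isOpen_pi_iff.1 hU x hx
  obtain ⟨n, hn⟩ := Infinite.exists_notMem_finset I
  refine ⟨Function.update x n (!x n), hIU fun i hi => ?_, fun h => ?_⟩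
  · have hin : i ≠ n := by rintro rfl; exact hn hi
    rw [Function.update_of_ne hin]
    exact (hu i hi).2
  · have := congrFun h n
    simp at this

theorem NoIsolatedPoints.prod {X Y : Type} [TopologicalSpace X] [TopologicalSpace Y]
    (hY : NoIsolatedPoints Y) : NoIsolatedPoints (X × Y) := by
  rintro U hU ⟨x, y⟩ hx
  obtain ⟨y', hy', hne⟩ := hY {y | (x, y) ∈ U} (hU.preimage (by fun_prop)) y hx
  exact ⟨(x, y'), hy', fun h => hne (Prod.ext_iff.1 h).2⟩

/-- The joint labeling by finitely many labelings. -/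
theorem exists_joint_label {X I : Type} [Finite I] [TopologicalSpace X] (j : (I → ℕ) → ℕ)
    (p : I → C(X, ℕ)) : ∃ P : C(X, ℕ), ∀ x, P x = j fun i => p i x :=
  ⟨⟨fun x => j fun i => p i x, (continuous_of_discreteTopology (f := j)).comp
    (continuous_pi fun i => (p i).continuous)⟩, fun _ => rfl⟩

/-- A system whose finite itineraries agree with those of `α` is a factor of an action on the
Cantor space that is close to `α`. -/
theorem exists_action_factor {G Z : Type} [Group G]
    [TopologicalSpace Z] [CompactSpace Z] [T2Space Z] [TotallyDisconnectedSpace Z]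
    [SecondCountableTopology Z] {b : G → C(Z, Z)} (hb : IsSystem b) (p : C(Z, ℕ))
    (α : G → C(Cantor, Cantor)) (P : C(Cantor, ℕ)) (E : Finset G)
    (h : Set.range (fun x (g : E) => P (α g x)) = Set.range (fun z (g : E) => p (b g z))) :
    ∃ (β : ActSpace G) (θ : C(Cantor, Z)), Function.Surjective θ ∧
      (∀ g x, θ (β.1 g x) = b g (θ x)) ∧ ∀ g ∈ E, ∀ x, p (b g (θ x)) = P (α g x) := by
  obtain ⟨j, hj⟩ := exists_injective_nat (E → ℕ)
  obtain ⟨p', hp'⟩ := exists_joint_label j fun g : E =>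
    (p.comp (b g)).comp (ContinuousMap.fst (α := Z) (β := Cantor))
  obtain ⟨P', hP'⟩ := exists_joint_label j fun g : E => P.comp (α g)
  have hr : Set.range p' = Set.range P' := by
    have e1 : Set.range p' = j '' Set.range (fun z (g : E) => p (b g z)) := by
      rw [← Set.range_comp]
      ext n
      constructor
      · rintro ⟨z, rfl⟩
        exact ⟨z.1, (hp' z).symm⟩
      · rintro ⟨z, rfl⟩
        exact ⟨(z, fun _ => false), hp' _⟩
    have e2 : Set.range P' = j '' Set.range (fun x (g : E) => P (α g x)) := by
      rw [← Set.range_comp]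
      exact congrArg Set.range (funext hP')
    rw [e1, e2, h]
  obtain ⟨h, hh⟩ := exists_homeomorph_of_range_eq noIsolatedPoints_cantor.prod
    noIsolatedPoints_cantor p' P' hr
  let β : G → C(Cantor, Cantor) := fun g =>
    (⟨h, h.continuous⟩ : C(Z × Cantor, Cantor)).comp
      (((b g).prodMap (ContinuousMap.id Cantor)).comp ⟨h.symm, h.symm.continuous⟩)
  have hβ : ∀ g x, β g x = h (b g (h.symm x).1, (h.symm x).2) := fun g x => rfl
  refine ⟨⟨β, ?_, fun g k => ?_⟩, ContinuousMap.fst.comp ⟨h.symm, h.symm.continuous⟩, fun z => ?_,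
    fun g x => ?_, fun g hg x => ?_⟩
  · refine ContinuousMap.ext fun x => ?_
    rw [hβ, hb.1]
    simp
  · refine ContinuousMap.ext fun x => ?_
    change β (g * k) x = β g (β k x)
    rw [hβ, hβ, hβ, hb.2]
    simp
  · exact ⟨h (z, fun _ => false), by simp⟩
  · simp [hβ]
  · have h1 := hh (h.symm x)
    rw [h.apply_symm_apply, hP', hp'] at h1
    exact (congrFun (hj h1) ⟨g, hg⟩).symm

theorem continuous_comp_label {G : Type} [Group G] (P : C(Cantor, ℕ)) (g : G) :
    Continuous fun β : ActSpace G => P.comp (β.1 g) :=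
  (ContinuousMap.continuous_postcomp P).comp
    ((continuous_apply g).comp continuous_subtype_val)

theorem eventually_label_eq {G : Type} [Group G] (α : ActSpace G) (P : C(Cantor, ℕ))
    (E : Finset G) : ∀ᶠ β in 𝓝 α, ∀ g ∈ E, ∀ x, P (β.1 g x) = P (α.1 g x) := by
  rw [Filter.eventually_all_finset]
  intro g _
  have := discreteTopology_labelings Cantor
  have h := (continuous_comp_label P g).continuousAt.eventually_mem
    ((isOpen_discrete {P.comp (α.1 g)}).mem_nhds rfl)
  filter_upwards [h] with β hβ x
  exact DFunLike.congr_fun hβ x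

theorem exists_coordinates_of_mem_nhds {f : C(Cantor, Cantor)} {t : Set C(Cantor, Cantor)}
    (ht : t ∈ 𝓝 f) :
    ∃ I : Finset ℕ, ∀ f' : C(Cantor, Cantor), (∀ i ∈ I, ∀ x, f' x i = f x i) → f' ∈ t := by
  obtain ⟨V, hV, hVt⟩ :=
    (nhds_basis_uniformity ContinuousMap.hasBasis_compactConvergenceUniformity_of_compact).mem_iff.1 ht
  rw [Pi.uniformity, Filter.mem_iInf] at hV
  obtain ⟨I, hI, W, hW, rfl⟩ := hV
  refine ⟨hI.toFinset, fun f' h => hVt fun x => ?_⟩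
  refine Set.mem_iInter.2 fun i => ?_
  obtain ⟨S, hS, hSW⟩ := Filter.mem_comap.1 (hW i)
  apply hSW
  have := h i (by simp) x
  simp only [Set.mem_preimage, this]
  exact refl_mem_uniformity hS

theorem exists_label_of_mem_nhds {G : Type} [Group G] {α : ActSpace G} {U : Set (ActSpace G)}
    (hU : U ∈ 𝓝 α) : ∃ (P : C(Cantor, ℕ)) (E : Finset G),
      ∀ β : ActSpace G, (∀ g ∈ E, ∀ x, P (β.1 g x) = P (α.1 g x)) → β ∈ U := by
  classical
  obtain ⟨U', hU', hUU⟩ := mem_nhds_induced _ _ _ |>.1 hU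
  rw [nhds_pi, Filter.mem_pi] at hU'
  obtain ⟨E, hE, t, ht, hEt⟩ := hU'
  choose I hI using fun g => exists_coordinates_of_mem_nhds (ht g)
  let K : Finset ℕ := hE.toFinset.biUnion I
  obtain ⟨j, hj⟩ := exists_injective_nat (K → ℕ)
  obtain ⟨P, hP⟩ := exists_joint_label j fun k : K =>
    (⟨fun x : Cantor => (x k).toNat, (continuous_of_discreteTopology (f := Bool.toNat)).comp
      (continuous_apply _)⟩ : C(Cantor, ℕ))
  refine ⟨P, hE.toFinset, fun β hβ => hUU (hEt fun g hg => hI g _ fun i hi x => ?_)⟩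
  have h := hβ g (by simpa using hg) x
  rw [hP, hP] at h
  have := congrFun (hj h) ⟨i, Finset.mem_biUnion.2 ⟨g, by simpa using hg, hi⟩⟩
  simp only [ContinuousMap.coe_mk] at this
  revert this
  cases β.1 g x i <;> cases α.1 g x i <;> simp

theorem isClosed_isAction (G : Type) [Group G] :
    IsClosed {α : G → C(Cantor, Cantor) | IsAction G α} := by
  simp only [IsAction, Set.ofPred_and, Set.ofPred_forall]
  refine (isClosed_eq (continuous_apply _) continuous_const).inter
    (isClosed_iInter fun g => isClosed_iInter fun h => isClosed_eq (continuous_apply _) ?_)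
  exact (continuous_apply g).compCM (continuous_apply h)

theorem baireSpace_actSpace (G : Type) [Group G] [Countable G] : BaireSpace (ActSpace G) := by
  have : CompleteSpace (ActSpace G) := (isClosed_isAction G).completeSpace_coe
  have : (uniformity Bool).IsCountablyGenerated := by
    rw [DiscreteUniformity.eq_principal_setRelId Bool]
    infer_instance
  have : (uniformity (ActSpace G)).IsCountablyGenerated := by
    rw [uniformity_subtype]
    infer_instance
  infer_instance

theorem code_act {G X : Type} [Group G] [TopologicalSpace X] {a : G → C(X, X)} (ha : IsSystem a)
    (P : C(X, ℕ)) (g : G) (x : X) : code a P (a g x) = shift g (code a P x) := by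
  funext h
  simp only [code, shift, mul_inv_rev, inv_inv, ha.2, ContinuousMap.comp_apply]

theorem code_factor {G X Z : Type} [Group G] [TopologicalSpace X] [TopologicalSpace Z]
    {a : G → C(X, X)} {b : G → C(Z, Z)} {θ : X → Z} (hθ : ∀ g x, θ (a g x) = b g (θ x))
    {P : C(X, ℕ)} {p : C(Z, ℕ)} (hp : ∀ x, p (θ x) = P x) (x : X) :
    code a P x = code b p (θ x) := by
  funext g
  simp only [code, ← hp, hθ]

theorem range_code_factor {G X Z : Type} [Group G] [TopologicalSpace X] [TopologicalSpace Z]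
    {a : G → C(X, X)} {b : G → C(Z, Z)} {θ : X → Z} (hs : Function.Surjective θ)
    (hθ : ∀ g x, θ (a g x) = b g (θ x))
    {P : C(X, ℕ)} {p : C(Z, ℕ)} (hp : ∀ x, p (θ x) = P x) :
    Set.range (code a P) = Set.range (code b p) := by
  rw [← hs.range_comp]
  exact congrArg Set.range (funext (code_factor hθ hp))

/-- A variant of `exists_action_factor` in which the window contains the identity. -/
theorem exists_nearby_factor {G Z : Type} [Group G]
    [TopologicalSpace Z] [CompactSpace Z] [T2Space Z] [TotallyDisconnectedSpace Z]
    [SecondCountableTopology Z] {b : G → C(Z, Z)} (hb : IsSystem b) (p : C(Z, ℕ))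
    (α : ActSpace G) (P : C(Cantor, ℕ)) (E : Finset G) (hE : 1 ∈ E)
    (h : Set.range (fun x (g : E) => P (α.1 g x)) = Set.range (fun z (g : E) => p (b g z))) :
    ∃ (β : ActSpace G) (θ : C(Cantor, Z)), Function.Surjective θ ∧
      (∀ g x, θ (β.1 g x) = b g (θ x)) ∧ (∀ x, p (θ x) = P x) ∧
      ∀ g ∈ E, ∀ x, P (β.1 g x) = P (α.1 g x) := by
  obtain ⟨β, θ, hs, hθ, hp⟩ := exists_action_factor hb p α.1 P E h
  have h1 : ∀ x, p (θ x) = P x := by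
    intro x
    have := hp 1 hE x
    rwa [hb.1, α.2.1] at this
  refine ⟨β, θ, hs, hθ, h1, fun g hg x => ?_⟩
  rw [← h1, hθ, hp g hg]

/-- The actions near which the subshift coded by `P` does not change. -/
def stableSet {G : Type} [Group G] (P : C(Cantor, ℕ)) : Set (ActSpace G) :=
  {α | ∀ᶠ β in 𝓝 α, Set.range (code β.1 P) = Set.range (code α.1 P)}

theorem isOpen_stableSet {G : Type} [Group G] (P : C(Cantor, ℕ)) :
    IsOpen (stableSet P : Set (ActSpace G)) := by
  rw [isOpen_iff_mem_nhds]
  intro α hα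
  have h2 := eventually_eventually_nhds.2 hα
  filter_upwards [h2, hα] with β hβ hβα
  filter_upwards [hβ] with γ hγ
  rw [hγ, hβα]

theorem exists_window_of_mem_stableSet {G : Type} [Group G] {P : C(Cantor, ℕ)} {α : ActSpace G}
    (hα : α ∈ stableSet P) :
    ∃ (W : C(Cantor, ℕ)) (π : ℕ → ℕ) (E : Finset G), 1 ∈ E ∧ P = labelMap π W ∧
      ∀ (Z : Type) [TopologicalSpace Z] [CompactSpace Z] [T2Space Z] [TotallyDisconnectedSpace Z]
        [SecondCountableTopology Z] (b : G → C(Z, Z)) (_ : IsSystem b) (p : C(Z, ℕ)),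
        Set.range (fun z (g : E) => p (b g z)) = Set.range (fun x (g : E) => W (α.1 g x)) →
        Set.range (code b (labelMap π p)) = Set.range (code α.1 P) := by
  classical
  obtain ⟨P₁, E, hE⟩ := exists_label_of_mem_nhds hα
  refine ⟨labelPair P₁ P, fun n => (Nat.unpair n).2, insert 1 E, Finset.mem_insert_self _ _,
    by ext x; simp, fun Z _ _ _ _ _ b hb p h => ?_⟩
  obtain ⟨β, θ, hs, hθ, hp, hβ⟩ := exists_nearby_factor hb p α _ _ (Finset.mem_insert_self _ _)
    h.symm
  have hβ' : Set.range (code β.1 P) = Set.range (code α.1 P) := by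
    refine hE β fun g hg x => ?_
    have := hβ g (Finset.mem_insert_of_mem hg) x
    simp only [labelPair_apply, Nat.pair_eq_pair] at this
    exact this.1
  rw [← hβ']
  refine (range_code_factor hs hθ fun x => ?_).symm
  simp [hp]

theorem eq_of_forall_patterns_eq {G A : Type} [TopologicalSpace A] [DiscreteTopology A]
    {S T : Set (G → A)} (hS : IsClosed S) (hT : IsClosed T)
    (h : ∀ F : Finset G, patterns F S = patterns F T) : S = T := by
  have key : ∀ {S T : Set (G → A)}, IsClosed S → (∀ F : Finset G, patterns F S = patterns F T) →
      T ⊆ S := by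
    intro S T hS h x hx
    rw [← hS.closure_eq, mem_closure_iff]
    intro U hU hxU
    obtain ⟨F, u, hu, hFU⟩ := isOpen_pi_iff.1 hU x hxU
    have : (fun f : F => x f) ∈ patterns F S := by
      rw [h F]; exact ⟨x, hx, rfl⟩
    obtain ⟨y, hy, hyx⟩ := this
    refine ⟨y, hFU fun i hi => ?_, hy⟩
    have := congrFun hyx ⟨i, hi⟩
    simp only at this
    rw [this]
    exact (hu i hi).2
  exact (key hT fun F => (h F).symm).antisymm (key hS h)

theorem continuous_code {G X : Type} [Group G] [TopologicalSpace X] (a : G → C(X, X))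
    (P : C(X, ℕ)) : Continuous (code a P) :=
  continuous_pi fun g => (P.comp (a g⁻¹)).continuous

theorem isClosed_range_code {G X : Type} [Group G] [TopologicalSpace X] [CompactSpace X]
    (a : G → C(X, X)) (P : C(X, ℕ)) : IsClosed (Set.range (code a P)) :=
  (isCompact_range (continuous_code a P)).isClosed

theorem eventually_code_eq {G : Type} [Group G] (α : ActSpace G) (P : C(Cantor, ℕ))
    (F : Finset G) : ∀ᶠ β in 𝓝 α, ∀ g ∈ F, ∀ x, code β.1 P x g = code α.1 P x g := by
  classical
  filter_upwards [eventually_label_eq α P (F.image fun g => g⁻¹)] with β hβ g hg x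
  exact hβ g⁻¹ (Finset.mem_image_of_mem _ hg) x

theorem patterns_range_congr {G X A : Type} {F : Finset G} {c d : X → G → A}
    (h : ∀ g ∈ F, ∀ x, c x g = d x g) :
    patterns F (Set.range c) = patterns F (Set.range d) := by
  simp only [patterns, ← Set.range_comp]
  congr 1
  funext x
  funext g
  exact h g g.2 x

theorem isClosed_setOf_range_code_eq {G : Type} [Group G] (P : C(Cantor, ℕ)) {S : Set (G → ℕ)}
    (hS : IsClosed S) : IsClosed {β : ActSpace G | Set.range (code β.1 P) = S} := by
  rw [← isOpen_compl_iff, isOpen_iff_mem_nhds]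
  intro β hβ
  have : ∃ F : Finset G, patterns F (Set.range (code β.1 P)) ≠ patterns F S := by
    by_contra! h
    exact hβ (eq_of_forall_patterns_eq (isClosed_range_code _ _) hS h)
  obtain ⟨F, hF⟩ := this
  filter_upwards [eventually_code_eq β P F] with γ hγ hγS
  have hγS : Set.range (code γ.1 P) = S := hγS
  rw [← patterns_range_congr hγ, hγS] at hF
  exact hF rfl

theorem dense_stableSet_of_strp {G : Type} [Group G] [Countable G] (h : HasSTRP G)
    (P : C(Cantor, ℕ)) : Dense (stableSet P : Set (ActSpace G)) := by
  have := baireSpace_actSpace G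
  have := countable_labelings Cantor
  obtain ⟨α, hα⟩ := h
  obtain ⟨s, hs, hsG, hsd⟩ := mem_residual.1 hα
  have hd := hsG.dense_iUnion_interior_of_closed hsd
    (f := fun Q : C(Cantor, ℕ) => {β : ActSpace G | Set.range (code β.1 P) = Set.range (code α.1 Q)})
    (fun Q => isClosed_setOf_range_code_eq P (isClosed_range_code _ _)) (by
      intro β hβ
      obtain ⟨φ, hφ⟩ := hs hβ
      refine Set.mem_iUnion.2 ⟨P.comp ⟨φ, φ.continuous⟩, ?_⟩
      refine (range_code_factor φ.surjective (fun g x => ?_) fun x => rfl).symm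
      rw [hφ]
      simp)
  refine hd.mono (Set.iUnion_subset fun Q β hβ => ?_)
  have h1 : β ∈ {β : ActSpace G | Set.range (code β.1 P) = Set.range (code α.1 Q)} :=
    interior_subset hβ
  filter_upwards [mem_interior_iff_mem_nhds.1 hβ] with γ hγ
  exact Eq.trans hγ (Eq.symm h1)

theorem exists_stable_extension {G : Type} [Group G] {P P' P₂ : C(Cantor, ℕ)} {α β₀ : ActSpace G}
    (hα : α ∈ stableSet (labelPair P P'))
    (hS : Set.range (code β₀.1 P₂) = Set.range (code α.1 P)) {U : Set (ActSpace G)}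
    (hU : U ∈ 𝓝 β₀) :
    ∃ β ∈ U, ∃ q' : C(Cantor, ℕ), ∀ᶠ β' in 𝓝 β,
      Set.range (code β'.1 (labelPair P₂ q')) = Set.range (code α.1 (labelPair P P')) := by
  classical
  obtain ⟨W, π, E, hE, hW, hrob⟩ := exists_window_of_mem_stableSet hα
  obtain ⟨P₃, E₃, hU'⟩ := exists_label_of_mem_nhds hU
  let Z : Set (Cantor × Cantor) := {z | code β₀.1 P₂ z.1 = code α.1 P z.2}
  have hZ : IsClosed Z := isClosed_eq ((continuous_code _ _).comp continuous_fst)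
    ((continuous_code _ _).comp continuous_snd)
  have : CompactSpace Z := isCompact_iff_compactSpace.1 hZ.isCompact
  have hbZ : ∀ (g : G) (z : Z), (β₀.1 g z.1.1, α.1 g z.1.2) ∈ Z := by
    intro g z
    change code β₀.1 P₂ _ = code α.1 P _
    have hz : code β₀.1 P₂ z.1.1 = code α.1 P z.1.2 := z.2
    rw [code_act β₀.2, code_act α.2, hz]
  let b : G → C(Z, Z) := fun g => ⟨fun z => ⟨_, hbZ g z⟩, by fun_prop⟩
  have hb : IsSystem b := by
    refine ⟨ContinuousMap.ext fun z => Subtype.ext ?_,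
      fun g h => ContinuousMap.ext fun z => Subtype.ext ?_⟩
    · change (β₀.1 1 z.1.1, α.1 1 z.1.2) = z.1
      rw [β₀.2.1, α.2.1]
      rfl
    · change (β₀.1 (g * h) z.1.1, α.1 (g * h) z.1.2) =
        (β₀.1 g (β₀.1 h z.1.1), α.1 g (α.1 h z.1.2))
      rw [β₀.2.2, α.2.2]
      rfl
  have hfst : ∀ x, ∃ z : Z, z.1.1 = x := by
    intro x
    obtain ⟨y, hy⟩ : code β₀.1 P₂ x ∈ Set.range (code α.1 P) := hS ▸ ⟨x, rfl⟩
    exact ⟨⟨(x, y), hy.symm⟩, rfl⟩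
  have hsnd : ∀ y, ∃ z : Z, z.1.2 = y := by
    intro y
    obtain ⟨x, hx⟩ : code α.1 P y ∈ Set.range (code β₀.1 P₂) := hS ▸ ⟨y, rfl⟩
    exact ⟨⟨(x, y), hx⟩, rfl⟩
  let p : C(Z, ℕ) := (labelPair P₃ P₂).comp ⟨fun z => z.1.1, by fun_prop⟩
  obtain ⟨β, θ, hs, hθ, hp, hβ⟩ := exists_nearby_factor hb p β₀ (labelPair P₃ P₂) (insert 1 E₃)
    (Finset.mem_insert_self _ _) (by
      ext w
      constructor
      · rintro ⟨x, rfl⟩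
        obtain ⟨z, rfl⟩ := hfst x
        exact ⟨z, rfl⟩
      · rintro ⟨z, rfl⟩
        exact ⟨z.1.1, rfl⟩)
  have hβU : β ∈ U := by
    refine hU' β fun g hg x => ?_
    have := hβ g (Finset.mem_insert_of_mem hg) x
    simp only [labelPair_apply, Nat.pair_eq_pair] at this
    exact this.1
  let W₂ : C(Cantor, ℕ) := W.comp ((⟨fun z => z.1.2, by fun_prop⟩ : C(Z, Cantor)).comp θ)
  refine ⟨β, hβU, labelMap (fun n => (Nat.unpair (π n)).2) W₂, ?_⟩
  have hpair : labelPair P₂ (labelMap (fun n => (Nat.unpair (π n)).2) W₂) = labelMap π W₂ := by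
    ext x
    have h1 : P₂ (θ x).1.1 = P₂ x := by
      have := hp x
      simp only [p, ContinuousMap.comp_apply, labelPair_apply, Nat.pair_eq_pair] at this
      exact this.2
    have h2 : P₂ (θ x).1.1 = P (θ x).1.2 := by
      have hz : code β₀.1 P₂ (θ x).1.1 = code α.1 P (θ x).1.2 := (θ x).2
      have := congrFun hz 1
      simp only [code, inv_one, β₀.2.1, α.2.1] at this
      exact this
    have h3 : Nat.pair (P (θ x).1.2) (P' (θ x).1.2) = π (W (θ x).1.2) :=
      DFunLike.congr_fun hW (θ x).1.2
    change Nat.pair (P₂ x) (Nat.unpair (π (W (θ x).1.2))).2 = π (W (θ x).1.2)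
    rw [← h3, Nat.unpair_pair, ← h1, h2]
  rw [hpair]
  filter_upwards [eventually_label_eq β W₂ E] with β' hβ'
  refine hrob Cantor β'.1 β'.2 W₂ ?_
  ext w
  have hW₂ : ∀ x, (fun g : E => W₂ (β'.1 g x)) = fun g : E => W (α.1 g (θ x).1.2) := by
    intro x
    funext g
    rw [hβ' g g.2 x]
    change W (θ (β.1 g x)).1.2 = _
    rw [hθ]
    rfl
  constructor
  · rintro ⟨x, rfl⟩
    exact ⟨(θ x).1.2, (hW₂ x).symm⟩
  · rintro ⟨y, rfl⟩
    obtain ⟨z, rfl⟩ := hsnd y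
    obtain ⟨x, rfl⟩ := hs z
    exact ⟨x, hW₂ x⟩

theorem residual_extension {G : Type} [Group G]
    (hd : ∀ P : C(Cantor, ℕ), Dense (stableSet P : Set (ActSpace G)))
    {P P' : C(Cantor, ℕ)} (P₂ : C(Cantor, ℕ)) {α : ActSpace G}
    (hα : α ∈ stableSet (labelPair P P')) :
    {β : ActSpace G | Set.range (code β.1 P₂) = Set.range (code α.1 P) → ∃ q' : C(Cantor, ℕ),
      Set.range (code β.1 (labelPair P₂ q')) = Set.range (code α.1 (labelPair P P'))} ∈
      residual (ActSpace G) := by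
  refine Filter.mem_of_superset (residual_of_dense_open (s := interior _) isOpen_interior ?_)
    interior_subset
  rw [dense_iff_inter_open]
  intro U hU hne
  obtain ⟨β₀, hβ₀U, hβ₀⟩ := (dense_iff_inter_open.1 (hd P₂)) U hU hne
  by_cases hS : Set.range (code β₀.1 P₂) = Set.range (code α.1 P)
  · obtain ⟨β, hβU, q', hβ⟩ := exists_stable_extension hα hS (hU.mem_nhds hβ₀U)
    refine ⟨β, hβU, mem_interior_iff_mem_nhds.2 ?_⟩
    filter_upwards [hβ] with γ hγ _
    exact ⟨q', hγ⟩
  · refine ⟨β₀, hβ₀U, mem_interior_iff_mem_nhds.2 ?_⟩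
    filter_upwards [hβ₀] with γ hγ h
    exact absurd (hγ.symm.trans h) hS

theorem strp_of_dense_stableSet {G : Type} [Group G] [Countable G]
    (hd : ∀ P : C(Cantor, ℕ), Dense (stableSet P : Set (ActSpace G))) : HasSTRP G := by
  have := baireSpace_actSpace G
  have := countable_labelings Cantor
  have : SecondCountableTopology C(Cantor, Cantor) := inferInstance
  have : SecondCountableTopology (G → C(Cantor, Cantor)) := inferInstance
  have : SecondCountableTopology (ActSpace G) := TopologicalSpace.Subtype.secondCountableTopology _
  obtain ⟨D, hDc, hDd⟩ := TopologicalSpace.exists_countable_dense (ActSpace G)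
  have : Countable D := hDc.to_subtype
  let good : Set (ActSpace G) := {β | (∀ P, β ∈ stableSet P) ∧
    ∀ (α : D) (P P' P₂ : C(Cantor, ℕ)), α.1 ∈ stableSet (labelPair P P') →
      Set.range (code β.1 P₂) = Set.range (code α.1.1 P) → ∃ q' : C(Cantor, ℕ),
      Set.range (code β.1 (labelPair P₂ q')) = Set.range (code α.1.1 (labelPair P P'))}
  have hgood : good ∈ residual (ActSpace G) := by
    refine Filter.inter_mem (f := residual (ActSpace G)) ?_ ?_
    · refine Filter.mem_of_superset (countable_iInter_mem.2 fun P =>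
        residual_of_dense_open (isOpen_stableSet P) (hd P)) fun β hβ P => Set.mem_iInter.1 hβ P
    · change ∀ᶠ β in residual (ActSpace G), _
      simp only [eventually_countable_forall]
      exact fun α P P' P₂ h => residual_extension hd P₂ h
  have forth : ∀ α ∈ good, ∀ β ∈ good, ∀ P P₂ P' : C(Cantor, ℕ),
      Set.range (code α.1 P) = Set.range (code β.1 P₂) → ∃ q' : C(Cantor, ℕ),
      Set.range (code α.1 (labelPair P P')) = Set.range (code β.1 (labelPair P₂ q')) := by
    intro α hα β hβ P P₂ P' h
    have h1 := hα.1 (labelPair P P')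
    have h2 := hα.1 P
    obtain ⟨γ, hγD, ⟨hγ1, hγ2⟩, hγ3⟩ := hDd.inter_nhds_nonempty
      (Filter.inter_mem (Filter.inter_mem h1 h2) ((isOpen_stableSet _).mem_nhds h1))
    have hγ1 : Set.range (code γ.1 (labelPair P P')) = Set.range (code α.1 (labelPair P P')) := hγ1
    have hγ2 : Set.range (code γ.1 P) = Set.range (code α.1 P) := hγ2
    obtain ⟨q', hq'⟩ := hβ.2 ⟨γ, hγD⟩ P P' P₂ hγ3 (by rw [hγ2, h])
    exact ⟨q', by rw [hq', hγ1]⟩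
  obtain ⟨α, hα⟩ := (dense_of_mem_residual hgood).nonempty_iff.2
    ⟨fun _ => ContinuousMap.id _, rfl, fun _ _ => rfl⟩
  refine ⟨α, Filter.mem_of_superset hgood fun β hβ => ?_⟩
  have hone : ∀ γ : ActSpace G, γ.1 (1 : G)⁻¹ = ContinuousMap.id Cantor := fun γ => by
    rw [inv_one]; exact γ.2.1
  obtain ⟨h, -, hh⟩ := exists_homeomorph_of_backForth (ι := G) 1 (fun g => α.1 g⁻¹)
    (fun g => β.1 g⁻¹) (hone α) (hone β) (fun p q p' hpq => forth α hα β hβ p q p' hpq)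
    (fun p q q' hpq => (forth β hβ α hα q p q' hpq.symm).imp fun _ h => h.symm) 0 0 (by
      ext w
      simp)
  refine ⟨h, fun g => funext fun y => ?_⟩
  have := hh g⁻¹ (h.symm y)
  rw [inv_inv, h.apply_symm_apply] at this
  exact this.symm

theorem isSubshift_iff {G A : Type} [Group G] [t : TopologicalSpace A] [DiscreteTopology A]
    {X : Set (G → A)} :
    IsSubshift G A X ↔ IsClosed X ∧ ∀ g : G, ∀ x ∈ X, shift g x ∈ X := by
  obtain rfl : t = ⊥ := DiscreteTopology.eq_bot
  exact Iff.rfl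

theorem continuousOnD_iff {G A B : Type} [t : TopologicalSpace A] [DiscreteTopology A]
    [t' : TopologicalSpace B] [DiscreteTopology B] {ψ : (G → B) → (G → A)} {Z : Set (G → B)} :
    ContinuousOnD ψ Z ↔ ContinuousOn ψ Z := by
  obtain rfl : t = ⊥ := DiscreteTopology.eq_bot
  obtain rfl : t' = ⊥ := DiscreteTopology.eq_bot
  exact Iff.rfl

theorem isClopenPartitionIn_iff {G A : Type} [t : TopologicalSpace A] [DiscreteTopology A]
    {X : Set (G → A)} {parts : Finset (Set (G → A))} :
    IsClopenPartitionIn X parts ↔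
      (∀ P ∈ parts, P.Nonempty ∧ P ⊆ X ∧ IsClopen (Subtype.val ⁻¹' P : Set X)) ∧
      (∀ P ∈ parts, ∀ Q ∈ parts, P ≠ Q → Disjoint P Q) ∧ (⋃ P ∈ parts, P) = X := by
  obtain rfl : t = ⊥ := DiscreteTopology.eq_bot
  exact Iff.rfl

theorem patterns_eq_iff {G A : Type} {F : Finset G} {X Y : Set (G → A)} :
    patterns F X = patterns F Y ↔ (∀ x ∈ X, ∃ y ∈ Y, ∀ g ∈ F, y g = x g) ∧
      ∀ y ∈ Y, ∃ x ∈ X, ∀ g ∈ F, x g = y g := by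
  simp only [patterns, Set.Subset.antisymm_iff, Set.image_subset_iff]
  simp only [Set.subset_def, Set.mem_preimage, Set.mem_image, funext_iff, Subtype.forall]

theorem shift_one {G A : Type} [Group G] (x : G → A) : shift 1 x = x := by
  funext h
  simp [shift]

theorem shift_shift {G A : Type} [Group G] (g h : G) (x : G → A) :
    shift g (shift h x) = shift (g * h) x := by
  funext k
  simp [shift, mul_assoc]

theorem continuous_shift {G A : Type} [Group G] [TopologicalSpace A] (g : G) :
    Continuous (shift g : (G → A) → (G → A)) :=
  continuous_pi fun h => continuous_apply (g⁻¹ * h)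

/-- The subshift of finite type of all configurations whose patterns with window `E` occur
in `X`. -/
def patternSFT {G A : Type} [Group G] (E : Finset G) (X : Set (G → A)) : Set (G → A) :=
  {y | ∀ g, ∃ x ∈ X, ∀ e ∈ E, shift g y e = x e}

theorem isSFT_patternSFT {G A : Type} [Group G] (E : Finset G) (X : Set (G → A)) :
    IsSFT G A (patternSFT E X) := by
  refine ⟨E, patterns E X, fun y => forall_congr' fun g => ?_⟩
  simp only [patterns, Set.mem_image, funext_iff, Subtype.forall, eq_comm]

theorem subset_patternSFT {G A : Type} [Group G] (E : Finset G) {X : Set (G → A)}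
    (hX : ∀ g : G, ∀ x ∈ X, shift g x ∈ X) : X ⊆ patternSFT E X :=
  fun x hx g => ⟨_, hX g x hx, fun _ _ => rfl⟩

theorem exists_agree_of_mem_patternSFT {G A : Type} [Group G] {E : Finset G} {X : Set (G → A)}
    {y : G → A} (hy : y ∈ patternSFT E X) : ∃ x ∈ X, ∀ e ∈ E, x e = y e := by
  obtain ⟨x, hx, h⟩ := hy 1
  exact ⟨x, hx, fun e he => by rw [← h e he, shift_one]⟩

theorem isSubshift_patternSFT {G A : Type} [Group G] (E : Finset G) (X : Set (G → A)) :
    IsSubshift G A (patternSFT E X) := by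
  let : TopologicalSpace A := ⊥
  have : DiscreteTopology A := ⟨rfl⟩
  refine isSubshift_iff.2 ⟨?_, fun g y hy h => ?_⟩
  · have : patternSFT E X = ⋂ g : G, (fun (y : G → A) (e : E) => shift g y e) ⁻¹' patterns E X := by
      ext y
      simp only [patternSFT, patterns, Set.mem_iInter, Set.mem_preimage, Set.mem_image,
        Set.mem_ofPred_eq, funext_iff, Subtype.forall, eq_comm]
    rw [this]
    exact isClosed_iInter fun g => (isClosed_discrete (patterns E X)).preimage
      (continuous_pi fun e : E => (continuous_apply (e : G)).comp (continuous_shift g))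
  · rw [shift_shift]
    exact hy (h * g)

theorem IsSFT.exists_window {G A : Type} [Group G] {Z : Set (G → A)} (hZ : IsSFT G A Z) :
    ∃ E : Finset G, ∀ y, (∀ g, ∃ z ∈ Z, ∀ e ∈ E, shift g y e = z e) → y ∈ Z := by
  obtain ⟨E, 𝔽, hE⟩ := hZ
  refine ⟨E, fun y hy => (hE y).2 fun g => ?_⟩
  obtain ⟨z, hz, h⟩ := hy g
  have := (hE z).1 hz 1
  rw [shift_one] at this
  convert this using 2 with e
  exact h e e.2

theorem exists_window_of_continuousOn {G A M : Type} [TopologicalSpace A] [DiscreteTopology A]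
    [TopologicalSpace M] [DiscreteTopology M] {V : Set (G → A)} (hV : IsCompact V)
    {f : (G → A) → M} (hf : ContinuousOn f V) :
    ∃ D : Finset G, ∀ v ∈ V, ∀ w ∈ V, (∀ g ∈ D, v g = w g) → f v = f w := by
  classical
  have key : ∀ v : G → A, v ∈ V → ∃ F : Finset G, ∀ w ∈ V, (∀ g ∈ F, w g = v g) → f w = f v := by
    intro v hv
    have h1 : {w | f w = f v} ∈ 𝓝[V] v := hf v hv ((isOpen_discrete {f v}).mem_nhds rfl)
    obtain ⟨U, hU, hvU, hUV⟩ := mem_nhdsWithin.1 h1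
    obtain ⟨F, u, hu, hFU⟩ := isOpen_pi_iff.1 hU v hvU
    exact ⟨F, fun w hw h => hUV ⟨hFU fun i hi => h i hi ▸ (hu i hi).2, hw⟩⟩
  choose! F hF using key
  obtain ⟨t, htV, ht⟩ := hV.elim_nhds_subcover (fun v => {w | ∀ g ∈ F v, w g = v g}) fun v _ =>
    (Filter.eventually_all_finset (F v)).2 fun g _ =>
      (continuous_apply g).continuousAt.eventually_mem ((isOpen_discrete {v g}).mem_nhds rfl)
  refine ⟨t.biUnion F, fun v hv w hw h => ?_⟩
  obtain ⟨u, hut, hu⟩ := Set.mem_iUnion₂.1 (ht hv)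
  rw [hF u (htV u hut) v hv hu, hF u (htV u hut) w hw fun g hg => ?_]
  rw [← h g (Finset.mem_biUnion.2 ⟨u, hut, hg⟩), hu g hg]

theorem exists_clopenPartitionIn {G A M : Type} [TopologicalSpace A] [DiscreteTopology A]
    [TopologicalSpace M] [DiscreteTopology M] [Finite M] {V : Set (G → A)}
    {f : (G → A) → M} (hf : ContinuousOn f V) :
    ∃ parts : Finset (Set (G → A)), IsClopenPartitionIn V parts ∧
      ∀ v ∈ V, {w ∈ V | f w = f v} ∈ parts := by
  classical
  refine ⟨((f '' V).toFinite.toFinset).image fun m => {w ∈ V | f w = m},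
    isClopenPartitionIn_iff.2 ⟨?_, ?_, ?_⟩, fun v hv => ?_⟩
  · simp only [Finset.mem_image, Set.Finite.mem_toFinset, forall_exists_index, and_imp]
    rintro _ _ ⟨v, hv, rfl⟩ rfl
    refine ⟨⟨v, hv, rfl⟩, fun w hw => hw.1, ?_⟩
    convert (isClopen_discrete {f v}).preimage (continuousOn_iff_continuous_domRestrict.1 hf) using 1
    ext w
    simp
  · simp only [Finset.mem_image, Set.Finite.mem_toFinset, forall_exists_index, and_imp]
    rintro _ m - rfl _ m' - rfl hne
    refine Set.disjoint_left.2 fun w hw hw' => hne ?_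
    rw [← hw.2, hw'.2]
  · ext w
    simp only [Finset.mem_image, Set.Finite.mem_toFinset, Set.mem_iUnion, exists_prop]
    constructor
    · rintro ⟨_, ⟨m, -, rfl⟩, hw⟩
      exact hw.1
    · exact fun hw => ⟨_, ⟨f w, ⟨w, hw, rfl⟩, rfl⟩, hw, rfl⟩
  · exact Finset.mem_image_of_mem _ ((Set.Finite.mem_toFinset _).2 ⟨v, hv, rfl⟩)

/-- The shift action on an invariant set. -/
def shiftSystem {G A : Type} [Group G] [TopologicalSpace A] {V : Set (G → A)}
    (hV : ∀ g : G, ∀ v ∈ V, shift g v ∈ V) (g : G) : C(V, V) :=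
  ⟨fun v => ⟨shift g v.1, hV g v.1 v.2⟩, 
    ((continuous_shift g).comp continuous_subtype_val).subtype_mk _⟩

theorem isSystem_shiftSystem {G A : Type} [Group G] [TopologicalSpace A] {V : Set (G → A)}
    (hV : ∀ g : G, ∀ v ∈ V, shift g v ∈ V) : IsSystem (shiftSystem hV) :=
  ⟨ContinuousMap.ext fun v => Subtype.ext (shift_one v.1),
    fun g h => ContinuousMap.ext fun v => Subtype.ext (shift_shift g h v.1).symm⟩

/-- The labelling of `V` by the symbol of `ψ v` at the identity. -/
def symbolLabel {G A B : Type} [Group G] [TopologicalSpace A] [TopologicalSpace B]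
    [DiscreteTopology B] {V : Set (G → A)} {ψ : (G → A) → (G → B)} (hψ : ContinuousOn ψ V)
    (s : B → ℕ) : C(V, ℕ) :=
  ⟨fun v => s (ψ v.1 1), continuous_of_discreteTopology.comp
    ((continuous_apply 1).comp (continuousOn_iff_continuous_domRestrict.1 hψ))⟩

theorem code_symbolLabel {G A B : Type} [Group G] [TopologicalSpace A] [TopologicalSpace B]
    [DiscreteTopology B] {V : Set (G → A)} {ψ : (G → A) → (G → B)} (hψ : ContinuousOn ψ V)
    (s : B → ℕ) (hV : ∀ g : G, ∀ v ∈ V, shift g v ∈ V) (he : EquivariantOn ψ V) (v : V) :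
    code (shiftSystem hV) (symbolLabel hψ s) v = fun g => s (ψ v.1 g) := by
  funext g
  change s (ψ (shift g⁻¹ v.1) 1) = _
  rw [he _ _ v.2]
  simp [shift]

theorem range_window_eq_of_patterns_eq {G X Z : Type} [Group G] [DecidableEq G]
    [TopologicalSpace X] [TopologicalSpace Z]
    {a : G → C(X, X)} {b : G → C(Z, Z)} {P : C(X, ℕ)} {p : C(Z, ℕ)} {E : Finset G}
    (h : patterns (E.image fun g => g⁻¹) (Set.range (code a P)) =
      patterns (E.image fun g => g⁻¹) (Set.range (code b p))) :
    Set.range (fun x (g : E) => P (a g x)) = Set.range (fun z (g : E) => p (b g z)) := by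
  obtain ⟨h1, h2⟩ := patterns_eq_iff.1 h
  simp only [Set.forall_mem_range, Set.exists_range_iff, Finset.forall_mem_image, code,
    inv_inv] at h1 h2
  apply Set.Subset.antisymm
  · rintro _ ⟨x, rfl⟩
    obtain ⟨z, hz⟩ := h1 x
    exact ⟨z, funext fun g => hz g.2⟩
  · rintro _ ⟨z, rfl⟩
    obtain ⟨x, hx⟩ := h2 z
    exact ⟨x, funext fun g => hx g.2⟩

/-- The itinerary of points of `X` with respect to a labelling `t`. -/
def itinerary {G X B : Type} [Group G] [TopologicalSpace X] (a : G → C(X, X)) (t : X → B)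
    (x : X) : G → B :=
  fun g => t (a g⁻¹ x)

theorem itinerary_act {G X B : Type} [Group G] [TopologicalSpace X] {a : G → C(X, X)}
    (ha : IsSystem a) (t : X → B) (g : G) (x : X) :
    itinerary a t (a g x) = shift g (itinerary a t x) := by
  funext h
  simp only [itinerary, shift, mul_inv_rev, inv_inv, ha.2, ContinuousMap.comp_apply]

theorem isSubshift_range_itinerary {G X B : Type} [Group G] [TopologicalSpace X] [CompactSpace X]
    [TopologicalSpace B] [DiscreteTopology B] {a : G → C(X, X)} (ha : IsSystem a) {t : X → B}
    (ht : Continuous t) : IsSubshift G B (Set.range (itinerary a t)) := by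
  refine isSubshift_iff.2 ⟨(isCompact_range ?_).isClosed, ?_⟩
  · exact continuous_pi fun g => ht.comp (a g⁻¹).continuous
  · rintro g _ ⟨x, rfl⟩
    exact ⟨a g x, itinerary_act ha t g x⟩

theorem exists_label_lt {X : Type} [TopologicalSpace X] [CompactSpace X] (P : C(X, ℕ)) :
    ∃ N, 2 ≤ N ∧ ∀ x, P x < N := by
  obtain ⟨M, hM⟩ := (isCompact_range P.continuous).bddAbove
  exact ⟨M + 2, by omega, fun x => by have := hM ⟨x, rfl⟩; omega⟩

theorem itinerary_symbol {G X A : Type} [Group G] [TopologicalSpace X] [TopologicalSpace A]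
    {V : Set (G → A)} (hV : ∀ g : G, ∀ v ∈ V, shift g v ∈ V) {a : G → C(X, X)} {θ : X → V}
    (hθ : ∀ g x, θ (a g x) = shiftSystem hV g (θ x)) (x : X) :
    itinerary a (fun x => (θ x).1 1) x = (θ x).1 := by
  funext g
  change (θ (a g⁻¹ x)).1 1 = _
  rw [hθ]
  change (θ x).1 (g⁻¹⁻¹ * 1) = _
  simp

/-- Near an action `β` factoring onto `V`, the itineraries of a labelling of `V` are shadowed by
points of `V`. -/
theorem eventually_range_code_eq_of_aMinimal {G B C : Type} [Group G]
    [TopologicalSpace B] [DiscreteTopology B] [TopologicalSpace C] [DiscreteTopology C]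
    [Countable C] {V : Set (G → C)} (hV : IsSubshift G C V) (hsft : IsSFT G C V)
    [CompactSpace V] {ψ : (G → C) → (G → B)} (hψ : ContinuousOn ψ V) (he : EquivariantOn ψ V)
    {parts : Finset (Set (G → C))} (hparts : IsClopenPartitionIn V parts)
    (hmin : AMinimal (ψ '' V) ((fun P => ψ '' P) '' (parts : Set (Set (G → C)))))
    {β : ActSpace G} {θ : C(Cantor, V)} (hs : Function.Surjective θ)
    (hθ : ∀ g x, θ (β.1 g x) = shiftSystem (isSubshift_iff.1 hV).2 g (θ x))
    {R : C(Cantor, ℕ)} {s : B → ℕ} (hR : ∀ x, s (ψ (θ x).1 1) = R x) :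
    ∀ᶠ β' in 𝓝 β, Set.range (code β'.1 R) = (fun y g => s (y g)) '' (ψ '' V) := by
  classical
  obtain ⟨κ, hκ⟩ := exists_injective_nat C
  let t : C(Cantor, C) := ⟨fun x => (θ x).1 1,
    (continuous_apply 1).comp (continuous_subtype_val.comp θ.continuous)⟩
  have hVc : IsCompact V := isCompact_iff_compactSpace.2 inferInstance
  obtain ⟨hclopen, -, hcover⟩ := isClopenPartitionIn_iff.1 hparts
  obtain ⟨D₁, hD₁⟩ := hsft.exists_window
  obtain ⟨D₂, hD₂⟩ := exists_window_of_continuousOn hVc (f := fun v => ψ v 1)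
    ((continuous_apply 1).comp_continuousOn hψ)
  have hD₃ : ∀ P ∈ parts, ∃ D : Finset G, ∀ v ∈ V, ∀ w ∈ V, (∀ g ∈ D, v g = w g) →
      P.boolIndicator v = P.boolIndicator w := fun P hP =>
    exists_window_of_continuousOn hVc
      ((continuousOn_boolIndicator_iff_isClopen _ _).2 (hclopen P hP).2.2)
  choose! D₃ hD₃ using hD₃
  have hitin : ∀ x, itinerary β.1 t x = (θ x).1 := itinerary_symbol _ hθ
  filter_upwards [eventually_code_eq β (⟨fun x => κ (t x),
    continuous_of_discreteTopology.comp t.continuous⟩) (D₁ ∪ (D₂ ∪ parts.biUnion D₃))]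
    with β' hβ'
  have hagree : ∀ x, ∀ g ∈ D₁ ∪ (D₂ ∪ parts.biUnion D₃), itinerary β'.1 t x g = (θ x).1 g := by
    intro x g hg
    rw [← hitin]
    exact hκ (hβ' g hg x)
  have hmem : ∀ x, itinerary β'.1 t x ∈ V := by
    refine fun x => hD₁ _ fun g => ⟨_, (θ (β'.1 g x)).2, fun e he => ?_⟩
    rw [← itinerary_act β'.2]
    exact hagree _ _ (Finset.mem_union_left _ he)
  have hcode : ∀ x, code β'.1 R x = fun g => s (ψ (itinerary β'.1 t x) g) := by
    intro x
    funext g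
    have h1 : ψ (itinerary β'.1 t (β'.1 g⁻¹ x)) 1 = ψ (itinerary β'.1 t x) g := by
      rw [itinerary_act β'.2, he _ _ (hmem x)]
      simp [shift]
    rw [← h1, hD₂ _ (hmem _) _ (θ (β'.1 g⁻¹ x)).2 fun h hh => hagree _ _ (by simp [hh]), hR]
    rfl
  have hrange : Set.range (fun x => ψ (itinerary β'.1 t x)) = ψ '' V := by
    by_contra hne
    have hsub : Set.range (fun x => ψ (itinerary β'.1 t x)) ⊆ ψ '' V := by
      rintro _ ⟨x, rfl⟩
      exact ⟨_, hmem x, rfl⟩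
    refine hmin ⟨_, isSubshift_iff.2 ⟨(isCompact_range ?_).isClosed, ?_⟩,
      Set.range_nonempty _, hsub.ssubset_of_ne hne, ?_⟩
    · exact hψ.comp_continuous
        (continuous_pi fun g => t.continuous.comp (β'.1 g⁻¹).continuous) hmem
    · rintro g _ ⟨x, rfl⟩
      refine ⟨β'.1 g x, ?_⟩
      change ψ (itinerary β'.1 t (β'.1 g x)) = _
      rw [itinerary_act β'.2, he _ _ (hmem x)]
    · rintro _ ⟨P, hP, rfl⟩
      obtain ⟨⟨v, hv⟩, hPV, -⟩ := hclopen P hP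
      obtain ⟨x, hx⟩ := hs ⟨v, hPV hv⟩
      have hxv : (θ x).1 = v := congrArg Subtype.val hx
      refine ⟨_, ⟨x, rfl⟩, _, ?_, rfl⟩
      rw [Set.mem_iff_boolIndicator, hD₃ P hP _ (hmem x) _ (θ x).2 fun g hg => hagree _ _ ?_, hxv,
        ← Set.mem_iff_boolIndicator]
      · exact hv
      · exact Finset.mem_union_right _ (Finset.mem_union_right _
          (Finset.mem_biUnion.2 ⟨P, hP, hg⟩))
  rw [← hrange, ← Set.range_comp]
  exact congrArg Set.range (funext hcode)

theorem dense_stableSet_of_aMinimal {G : Type} [Group G] [Countable G]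
    (h : ∀ N, 2 ≤ N → ∀ (Z : Set (G → Fin N)), IsSubshift G (Fin N) Z → IsSFT G (Fin N) Z →
      ∀ F : Finset G, ∃ Y : Set (G → Fin N), patterns F Y = patterns F Z ∧
        ∃ (C : Type) (_ : Fintype C) (V : Set (G → C)) (ψ : (G → C) → (G → Fin N))
          (parts : Finset (Set (G → C))),
          IsSubshift G C V ∧ IsSFT G C V ∧ ContinuousOnD ψ V ∧ EquivariantOn ψ V ∧ ψ '' V = Y ∧
          IsClopenPartitionIn V parts ∧
          AMinimal Y ((fun P => ψ '' P) '' (parts : Set (Set (G → C)))))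
    (P : C(Cantor, ℕ)) : Dense (stableSet P : Set (ActSpace G)) := by
  classical
  refine dense_iff_inter_open.2 fun U hU ⟨α, hα⟩ => ?_
  obtain ⟨P₁, E, hE⟩ := exists_label_of_mem_nhds (hU.mem_nhds hα)
  obtain ⟨N, hN, hR⟩ := exists_label_lt (labelPair P₁ P)
  let r : Cantor → Fin N := fun x => ⟨labelPair P₁ P x, hR x⟩
  obtain ⟨Y, hFY, C, _, V, ψ, parts, hV, hsft, hψ, he, rfl, hparts, hmin⟩ := h N hN
    (patternSFT ((insert 1 E).image fun g => g⁻¹) (Set.range (itinerary α.1 r)))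
    (isSubshift_patternSFT _ _) (isSFT_patternSFT _ _) ((insert 1 E).image fun g => g⁻¹)
  let : TopologicalSpace C := ⊥
  have : DiscreteTopology C := ⟨rfl⟩
  have hψ := continuousOnD_iff.1 hψ
  obtain ⟨hVc, hVi⟩ := isSubshift_iff.1 hV
  have : CompactSpace V := isCompact_iff_compactSpace.1 hVc.isCompact
  obtain ⟨hp1, hp2⟩ := patterns_eq_iff.1 hFY
  obtain ⟨β, θ, hs, hθ, hp, hβ⟩ := exists_nearby_factor (isSystem_shiftSystem hVi)
    (symbolLabel hψ Fin.val) α (labelPair P₁ P) (insert 1 E) (Finset.mem_insert_self _ _) (by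
      apply range_window_eq_of_patterns_eq
      simp only [patterns_eq_iff, Set.forall_mem_range, Set.exists_range_iff,
        code_symbolLabel hψ _ hVi he]
      constructor
      · intro x
        obtain ⟨_, ⟨v, hv, rfl⟩, h⟩ := hp2 (itinerary α.1 r x) (subset_patternSFT _
          (by rintro g _ ⟨x, rfl⟩; exact ⟨_, itinerary_act α.2 r g x⟩) ⟨x, rfl⟩)
        exact ⟨⟨v, hv⟩, fun g hg => congrArg Fin.val (h g hg)⟩
      · intro v
        obtain ⟨z, hz, h⟩ := hp1 _ ⟨v.1, v.2, rfl⟩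
        obtain ⟨_, ⟨x, rfl⟩, h'⟩ := exists_agree_of_mem_patternSFT hz
        exact ⟨x, fun g hg => congrArg Fin.val ((h' g hg).trans (h g hg))⟩)
  refine ⟨β, hE β fun g hg x => ?_, ?_⟩
  · have := hβ g (Finset.mem_insert_of_mem hg) x
    simp only [labelPair_apply, Nat.pair_eq_pair] at this
    exact this.1
  · have hev := eventually_range_code_eq_of_aMinimal hV hsft hψ he hparts hmin hs hθ (s := Fin.val) hp
    filter_upwards [hev] with β' hβ'
    have hP : ∀ γ : ActSpace G, Set.range (code γ.1 P) =
        (fun y g => (Nat.unpair (y g)).2) '' Set.range (code γ.1 (labelPair P₁ P)) := by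
      intro γ
      rw [← Set.range_comp]
      refine congrArg Set.range (funext fun x => funext fun g => ?_)
      simp [code]
    rw [hP, hP, hβ', hev.self_of_nhds]

/-- The subshift coded by `P` is the symbolwise image of every subshift having the same patterns
as `X` on a fixed finite window. -/
theorem exists_rigid_patternSFT {G : Type} [Group G] [Countable G] {α : ActSpace G}
    {P : C(Cantor, ℕ)} (hα : α ∈ stableSet P) :
    ∃ (N : ℕ) (_ : 2 ≤ N) (π : Fin N → ℕ) (E : Finset G) (X : Set (G → Fin N)),
      (∀ g : G, ∀ x ∈ X, shift g x ∈ X) ∧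
      ∀ V : Set (G → Fin N), IsSubshift G (Fin N) V → patterns E V = patterns E X →
        (fun v g => π (v g)) '' V = Set.range (code α.1 P) := by
  classical
  obtain ⟨W, π, E, -, -, hrob⟩ := exists_window_of_mem_stableSet hα
  obtain ⟨N, hN, hW⟩ := exists_label_lt W
  let w : Cantor → Fin N := fun x => ⟨W x, hW x⟩
  refine ⟨N, hN, fun n => π n, E.image fun g => g⁻¹, Set.range (itinerary α.1 w),
    ?_, fun V hV hVE => ?_⟩
  · rintro g _ ⟨x, rfl⟩
    exact ⟨_, itinerary_act α.2 w g x⟩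
  obtain ⟨hVc, hVi⟩ := isSubshift_iff.1 hV
  have : CompactSpace V := isCompact_iff_compactSpace.1 hVc.isCompact
  have hid : EquivariantOn (fun v : G → Fin N => v) V := fun _ _ _ => rfl
  obtain ⟨hp1, hp2⟩ := patterns_eq_iff.1 hVE
  rw [← hrob V (shiftSystem hVi) (isSystem_shiftSystem hVi)
    (symbolLabel (ψ := fun v => v) continuousOn_id Fin.val) ?_]
  · have : ∀ v : V, code (shiftSystem hVi) (labelMap π (symbolLabel (ψ := fun v => v)
        continuousOn_id Fin.val)) v = fun g => π (v.1 g) := fun v => funext fun g =>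
      congrArg π (congrFun (code_symbolLabel continuousOn_id Fin.val hVi hid v) g)
    rw [funext this, Set.image_eq_range]
  · apply range_window_eq_of_patterns_eq
    simp only [patterns_eq_iff, Set.forall_mem_range, Set.exists_range_iff,
      code_symbolLabel continuousOn_id Fin.val hVi hid]
    constructor
    · intro v
      obtain ⟨_, ⟨x, rfl⟩, h⟩ := hp1 v.1 v.2
      exact ⟨x, fun g hg => congrArg Fin.val (h g hg)⟩
    · intro x
      obtain ⟨v, hv, h⟩ := hp2 _ ⟨x, rfl⟩
      exact ⟨⟨v, hv⟩, fun g hg => congrArg Fin.val (h g hg)⟩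

theorem exists_stable_subshift {G : Type} [Group G] [Countable G]
    (hd : ∀ P : C(Cantor, ℕ), Dense (stableSet P : Set (ActSpace G)))
    {B : Type} [Finite B] {Z : Set (G → B)} (hZ : IsSubshift G B Z) (hsft : IsSFT G B Z)
    (hne : Z.Nonempty) {ν : B → ℕ} (hν : Function.Injective ν) (D : Finset G) :
    ∃ (Y : Set (G → B)) (α : ActSpace G) (P : C(Cantor, ℕ)), Y ⊆ Z ∧ IsSubshift G B Y ∧
      patterns D Y = patterns D Z ∧ α ∈ stableSet P ∧
      (fun y g => ν (y g)) '' Y = Set.range (code α.1 P) := by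
  classical
  let : TopologicalSpace B := ⊥
  have : DiscreteTopology B := ⟨rfl⟩
  obtain ⟨hZc, hZi⟩ := isSubshift_iff.1 hZ
  have : CompactSpace Z := isCompact_iff_compactSpace.1 hZc.isCompact
  have : Nonempty Z := hne.to_subtype
  obtain ⟨β, θ, hs, hθ, -⟩ := exists_action_factor (isSystem_shiftSystem hZi) 0
    (fun _ => ContinuousMap.id _) 0 ∅ (by
      ext w
      simp [funext_iff])
  let t : C(Cantor, B) := ⟨fun x => (θ x).1 1,
    (continuous_apply 1).comp (continuous_subtype_val.comp θ.continuous)⟩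
  let P : C(Cantor, ℕ) := ⟨fun x => ν (t x), continuous_of_discreteTopology.comp t.continuous⟩
  have hitin : ∀ x, itinerary β.1 t x = (θ x).1 := itinerary_symbol _ hθ
  obtain ⟨E, hE⟩ := hsft.exists_window
  obtain ⟨α, hαW, hα⟩ := (hd P).inter_nhds_nonempty (eventually_code_eq β P (E ∪ D))
  have hagree : ∀ x, ∀ g ∈ E ∪ D, itinerary α.1 t x g = (θ x).1 g := by
    intro x g hg
    rw [← hitin]
    exact hν (hα g hg x)
  refine ⟨Set.range (itinerary α.1 t), α, P, ?_, isSubshift_range_itinerary α.2 t.continuous,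
    ?_, hαW, ?_⟩
  · rintro _ ⟨x, rfl⟩
    refine hE _ fun g => ⟨_, (θ (α.1 g x)).2, fun e he => ?_⟩
    rw [← itinerary_act α.2]
    exact hagree _ _ (Finset.mem_union_left _ he)
  · refine patterns_eq_iff.2 ⟨?_, fun z hz => ?_⟩
    · rintro _ ⟨x, rfl⟩
      exact ⟨_, (θ x).2, fun g hg => (hagree x g (Finset.mem_union_right _ hg)).symm⟩
    · obtain ⟨x, hx⟩ := hs ⟨z, hz⟩
      refine ⟨_, ⟨x, rfl⟩, fun g hg => ?_⟩
      rw [hagree x g (Finset.mem_union_right _ hg), hx]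
  · rw [← Set.range_comp]
    rfl

theorem exists_aMinimal_of_dense_stableSet {G : Type} [Group G] [Countable G]
    (hd : ∀ P : C(Cantor, ℕ), Dense (stableSet P : Set (ActSpace G)))
    {A B : Type} [Finite A] [Finite B] [Nonempty B] {Z : Set (G → B)} (hZ : IsSubshift G B Z)
    (hsft : IsSFT G B Z) (hne : Z.Nonempty) {φ : (G → B) → (G → A)} (hφ : ContinuousOnD φ Z)
    (hφe : EquivariantOn φ Z) (F : Finset G) :
    ∃ Y : Set (G → B), Y ⊆ Z ∧ IsSubshift G B Y ∧ patterns F (φ '' Y) = patterns F (φ '' Z) ∧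
      ∃ (N : ℕ) (_ : 2 ≤ N) (V : Set (G → Fin N)) (ψ : (G → Fin N) → (G → B))
        (parts : Finset (Set (G → Fin N))),
        IsSubshift G (Fin N) V ∧ IsSFT G (Fin N) V ∧
        ContinuousOnD ψ V ∧ EquivariantOn ψ V ∧ ψ '' V = Y ∧
        IsClopenPartitionIn V parts ∧
        AMinimal (φ '' Y) ((fun P => φ '' (ψ '' P)) '' (parts : Set (Set (G → Fin N)))) := by
  let : TopologicalSpace A := ⊥
  have : DiscreteTopology A := ⟨rfl⟩
  let : TopologicalSpace B := ⊥
  have : DiscreteTopology B := ⟨rfl⟩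
  have hφ := continuousOnD_iff.1 hφ
  obtain ⟨ν, hν⟩ := exists_injective_nat B
  obtain ⟨r, hr⟩ := hν.hasLeftInverse
  obtain ⟨D, hD⟩ := exists_window_of_continuousOn (isSubshift_iff.1 hZ).1.isCompact
    (f := fun z (g : F) => φ z g) (continuousOn_pi.2 fun g =>
      (continuous_apply (g : G)).comp_continuousOn hφ)
  have hD : ∀ z ∈ Z, ∀ w ∈ Z, (∀ g ∈ D, z g = w g) → ∀ g ∈ F, φ z g = φ w g :=
    fun z hz w hw h g hg => congrFun (hD z hz w hw h) ⟨g, hg⟩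
  obtain ⟨Y, α, P, hYZ, hY, hYD, hα, hYα⟩ := exists_stable_subshift hd hZ hsft hne hν D
  obtain ⟨hYD₁, hYD₂⟩ := patterns_eq_iff.1 hYD
  obtain ⟨N, hN, π, E, X, hXi, hX⟩ := exists_rigid_patternSFT hα
  have hXV := subset_patternSFT E hXi
  obtain ⟨hVc, hVi⟩ := isSubshift_iff.1 (isSubshift_patternSFT E X)
  let ψ : (G → Fin N) → (G → B) := fun v g => r (π (v g))
  have hψ : Continuous ψ :=
    continuous_pi fun g =>
      (continuous_of_discreteTopology (f := fun n => r (π n))).comp (continuous_apply g)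
  have hrigid : ∀ V : Set (G → Fin N), IsSubshift G (Fin N) V → patterns E V = patterns E X →
      ψ '' V = Y := by
    intro V hV hVE
    have h1 : ψ '' V = (fun (y : G → ℕ) g => r (y g)) '' ((fun v g => π (v g)) '' V) := by
      rw [Set.image_image]
    rw [h1, hX V hV hVE, ← hYα, Set.image_image]
    simp only [hr _, Set.image_id']
  have hVY : ψ '' patternSFT E X = Y := hrigid _ (isSubshift_patternSFT E X)
    (patterns_eq_iff.2 ⟨fun v hv => exists_agree_of_mem_patternSFT hv,
      fun x hx => ⟨x, hXV hx, fun _ _ => rfl⟩⟩)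
  have hVZ : ∀ v ∈ patternSFT E X, ψ v ∈ Z := fun v hv => hYZ (hVY ▸ ⟨v, hv, rfl⟩)
  obtain ⟨parts, hparts, hmem⟩ := exists_clopenPartitionIn (V := patternSFT E X)
    (f := fun v (g : E) => v g) (by fun_prop)
  refine ⟨Y, hYZ, hY, ?_, N, hN, patternSFT E X, ψ, parts, isSubshift_patternSFT E X,
    isSFT_patternSFT E X, continuousOnD_iff.2 hψ.continuousOn, fun _ _ _ => rfl, hVY, hparts, ?_⟩
  · simp only [patterns_eq_iff, Set.forall_mem_image, Set.exists_mem_image]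
    constructor
    · exact fun y hy => ⟨y, hYZ hy, fun _ _ => rfl⟩
    · intro z hz
      obtain ⟨y, hy, h⟩ := hYD₂ z hz
      exact ⟨y, hy, hD y (hYZ hy) z hz h⟩
  · rintro ⟨Y', hY', -, hss, hmeet⟩
    obtain ⟨hYc', hYi'⟩ := isSubshift_iff.1 hY'
    have hV' : ψ '' {v ∈ patternSFT E X | φ (ψ v) ∈ Y'} = Y := by
      refine hrigid _ (isSubshift_iff.2 ⟨?_, ?_⟩) (patterns_eq_iff.2 ⟨?_, ?_⟩)
      · exact (hφ.comp hψ.continuousOn hVZ).preimage_isClosed_of_isClosed hVc hYc'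
      · rintro g v ⟨hv, hvY⟩
        refine ⟨hVi g v hv, ?_⟩
        change φ (shift g (ψ v)) ∈ Y'
        rw [hφe g _ (hVZ v hv)]
        exact hYi' g _ hvY
      · exact fun v hv => exists_agree_of_mem_patternSFT hv.1
      · intro x hx
        obtain ⟨_, hy, _, ⟨v, ⟨hv, hvx⟩, rfl⟩, rfl⟩ := hmeet _ ⟨_, hmem x (hXV hx), rfl⟩
        exact ⟨v, ⟨hv, hy⟩, fun g hg => congrFun hvx ⟨g, hg⟩⟩
    refine hss.2 ?_
    rintro _ ⟨y, hy, rfl⟩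
    rw [← hV'] at hy
    obtain ⟨v, hv, rfl⟩ := hy
    exact hv.2

/-- Characterization of the strong topological Rokhlin property via
`𝒜`-minimal sofic subshifts inside subshifts of finite type. -/
theorem strp_iff_aminimal_characterization (G : Type) [Group G] [Countable G] :
    HasSTRP G ↔
      ∀ (A : Type) (_ : Fintype A) (_ : Nontrivial A)
        (B : Type) (_ : Fintype B) (_ : Nontrivial B)
        (Z : Set (G → B)), IsSubshift G B Z → IsSFT G B Z →
        ∀ φ : (G → B) → (G → A), ContinuousOnD φ Z → EquivariantOn φ Z →
        ∀ F : Finset G,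
          ∃ Y : Set (G → B), Y ⊆ Z ∧ IsSubshift G B Y ∧ IsSofic G B Y ∧
            patterns F (φ '' Y) = patterns F (φ '' Z) ∧
            ∃ (C : Type) (_ : Fintype C) (_ : Nontrivial C)
              (V : Set (G → C)) (ψ : (G → C) → (G → B))
              (parts : Finset (Set (G → C))),
              IsSubshift G C V ∧ IsSFT G C V ∧
              ContinuousOnD ψ V ∧ EquivariantOn ψ V ∧ ψ '' V = Y ∧
              IsClopenPartitionIn V parts ∧
              AMinimal (φ '' Y)
                ((fun P => φ '' (ψ '' P)) '' (parts : Set (Set (G → C)))) := by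
  refine ⟨fun h A _ _ B _ _ Z hZ hsft φ hφ hφe F => ?_,
    fun h => strp_of_dense_stableSet (dense_stableSet_of_aMinimal fun N hN Z hZ hsft F => ?_)⟩
  · rcases Z.eq_empty_or_nonempty with rfl | hne
    · have hid : ContinuousOnD (fun z : G → B => z) ∅ := by
        let : TopologicalSpace B := ⊥
        have : DiscreteTopology B := ⟨rfl⟩
        exact continuousOnD_iff.2 (continuousOn_empty _)
      have hide : EquivariantOn (fun z : G → B => z) ∅ := fun _ _ _ => rfl
      have himg : (fun z : G → B => z) '' ∅ = ∅ := Set.image_empty _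
      refine ⟨∅, subset_rfl, hZ, ⟨B, inferInstance, inferInstance, ∅, _, hZ, hsft, hid, hide, himg⟩, rfl,
        B, inferInstance, inferInstance, ∅, _, ∅, hZ, hsft, hid, hide, himg, ?_, ?_⟩
      · simp [IsClopenPartitionIn]
      · rintro ⟨Y, -, hne, hss, -⟩
        obtain ⟨y, hy⟩ := hne
        obtain ⟨_, hz, -⟩ := hss.1 hy
        exact hz
    · obtain ⟨Y, hYZ, hY, hF, N, hN, V, ψ, parts, hV, hV', hψ, hψe, hVY, hparts, hmin⟩ :=
        exists_aMinimal_of_dense_stableSet (dense_stableSet_of_strp h) hZ hsft hne hφ hφe F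
      have : Nontrivial (Fin N) := Fin.nontrivial_iff_two_le.2 hN
      exact ⟨Y, hYZ, hY, ⟨Fin N, inferInstance, this, V, ψ, hV, hV', hψ, hψe, hVY⟩, hF,
        Fin N, inferInstance, this, V, ψ, parts, hV, hV', hψ, hψe, hVY, hparts, hmin⟩
  · have : Nontrivial (Fin N) := Fin.nontrivial_iff_two_le.2 hN
    obtain ⟨Y, -, -, -, hF, C, hC, -, V, ψ, parts, hV, hV', hψ, hψe, hVY, hparts, hmin⟩ :=
      h (Fin N) inferInstance this (Fin N) inferInstance this Z hZ hsft (fun z => z)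
        (continuousOnD_iff.2 continuousOn_id) (fun _ _ _ => rfl) F
    simp only [Set.image_id'] at hF hmin
    exact ⟨Y, hF, C, hC, V, ψ, parts, hV, hV', hψ, hψe, hVY, hparts, hmin⟩
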